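/- (Conditional form of Lemma 3.3.) Let n ≥ 3, let Ω ⊂ ℝⁿ be a bounded open set, let A : Ω → ℝ^{n×n} be measurable, let x0 ∈ Ω, and suppose |A(x) − A(x0)| ≤ Λ0 for all x ∈ Ω. Let y0 ∈ Ω with y0 ≠ x0 and set r := |x0 − y0|/5. Let δ > 0 and let η : ℝⁿ → ℝ be Lipschitz with 0 ≤ η ≤ 1 and Lipschitz constant ≤ 4/δ. Let C0 ≥ 0 and let G : Ω \ {x0} → ℝ be measurable with (i) |G(x)| ≤ C0 |x − x0|^{2−n} for all x ∈ Ω \ {x0}, and (ii) |G(x) − G(y)| ≤ C0 t r^{1−n} whenever t ∈ (0,r], x̄ ∈ Ω(y0, 2r), and x, y ∈ Ω(x̄, t). Define g := −η·(A − A(x0))·G on Ω \ {x0}. Then there exists C = C(n, Λ0, C0) such that for all t ∈ (0,r]: ω_g(t, Ω(y0,2r)) := sup_{x̄ ∈ Ω(y0,2r)} ω_g(t, x̄) ≤ C r^{2−n} ( ω_A(t) + ((r + δ)/(δ r)) · ϱ_A(8r, x0) · t ). -/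

import Mathlib

open MeasureTheory Metric Set

/-- Mean oscillation `ω_f(r,x) = ⨍_{Ω(x,r)} |f - f̄_{Ω(x,r)}|` over `Ω(x,r) = Ω ∩ B(x,r)`. -/
noncomputable def meanOsc (n : ℕ) {V : Type*} [NormedAddCommGroup V] [NormedSpace ℝ V]
    (Ω : Set (EuclideanSpace ℝ (Fin n))) (f : EuclideanSpace ℝ (Fin n) → V) (r : ℝ)
    (x : EuclideanSpace ℝ (Fin n)) : ℝ :=
  ⨍ y in Ω ∩ ball x r, ‖f y - ⨍ z in Ω ∩ ball x r, f z‖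

/-- `ω_f(r, D) = sup_{x ∈ D} ω_f(r,x)`. -/
noncomputable def meanOscSup (n : ℕ) {V : Type*} [NormedAddCommGroup V] [NormedSpace ℝ V]
    (Ω : Set (EuclideanSpace ℝ (Fin n))) (f : EuclideanSpace ℝ (Fin n) → V) (r : ℝ)
    (D : Set (EuclideanSpace ℝ (Fin n))) : ℝ :=
  sSup ((fun x => meanOsc n Ω f r x) '' D)

/-- `ϱ_A(r, x0) = sup {|A(x) - A(x0)| : x ∈ Ω, |x - x0| ≤ r}`. -/
noncomputable def modCont (n : ℕ) {V : Type*} [NormedAddCommGroup V]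
    (Ω : Set (EuclideanSpace ℝ (Fin n))) (A : EuclideanSpace ℝ (Fin n) → V) (r : ℝ)
    (x0 : EuclideanSpace ℝ (Fin n)) : ℝ :=
  sSup {d : ℝ | ∃ x ∈ Ω, dist x x0 ≤ r ∧ d = ‖A x - A x0‖}

/-- The mean oscillation is at most twice the mean distance to any constant. -/
lemma integral_norm_sub_integral_le {α V : Type*} [MeasurableSpace α] [NormedAddCommGroup V]
    [NormedSpace ℝ V] [CompleteSpace V] {ν : Measure α} [IsProbabilityMeasure ν] {f : α → V}
    (hf : Integrable f ν) (c : V) :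
    ∫ y, ‖f y - ∫ z, f z ∂ν‖ ∂ν ≤ 2 * ∫ y, ‖f y - c‖ ∂ν := by
  have hfc : Integrable (fun y => ‖f y - c‖) ν := (hf.sub (integrable_const c)).norm
  have hmean : ‖(∫ z, f z ∂ν) - c‖ ≤ ∫ y, ‖f y - c‖ ∂ν := by
    have h : ∫ y, (f y - c) ∂ν = (∫ z, f z ∂ν) - c := by
      rw [integral_sub hf (integrable_const c)]
      simp
    rw [← h]
    exact norm_integral_le_integral_norm _
  calc ∫ y, ‖f y - ∫ z, f z ∂ν‖ ∂ν
      ≤ ∫ y, (‖f y - c‖ + ‖(∫ z, f z ∂ν) - c‖) ∂ν := by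
        refine integral_mono (hf.sub (integrable_const _)).norm
          (hfc.add (integrable_const _)) fun y => ?_
        have := norm_sub_le (f y - c) ((∫ z, f z ∂ν) - c)
        simpa using this
    _ = (∫ y, ‖f y - c‖ ∂ν) + ‖(∫ z, f z ∂ν) - c‖ := by
        rw [integral_add hfc (integrable_const _)]
        simp
    _ ≤ 2 * ∫ y, ‖f y - c‖ ∂ν := by linarith

/-- Mean oscillation of a product `-h (A - a)` when `h` is close to a constant `h₀`. -/
lemma integral_norm_neg_smul_sub_integral_le {α V : Type*} [MeasurableSpace α]
    [NormedAddCommGroup V] [NormedSpace ℝ V] [CompleteSpace V] {ν : Measure α}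
    [IsProbabilityMeasure ν] {A : α → V} {h : α → ℝ} {a : V} {h₀ K M H : ℝ}
    (hA : Integrable A ν) (hg : Integrable (fun y => -(h y • (A y - a))) ν)
    (hK : ∀ᵐ y ∂ν, |h y - h₀| ≤ K) (hM : ∀ᵐ y ∂ν, ‖A y - a‖ ≤ M) (hH : |h₀| ≤ H) :
    ∫ y, ‖-(h y • (A y - a)) - ∫ z, -(h z • (A z - a)) ∂ν‖ ∂ν
      ≤ 2 * (K * M + H * ∫ y, ‖A y - ∫ z, A z ∂ν‖ ∂ν) := by
  have hosc : Integrable (fun y => ‖A y - ∫ z, A z ∂ν‖) ν :=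
    (hA.sub (integrable_const _)).norm
  refine (integral_norm_sub_integral_le hg (-(h₀ • ((∫ z, A z ∂ν) - a)))).trans ?_
  refine mul_le_mul_of_nonneg_left ?_ zero_le_two
  calc ∫ y, ‖-(h y • (A y - a)) - -(h₀ • ((∫ z, A z ∂ν) - a))‖ ∂ν
      ≤ ∫ y, (K * M + H * ‖A y - ∫ z, A z ∂ν‖) ∂ν := by
        refine integral_mono_ae (hg.sub (integrable_const _)).norm
          ((integrable_const _).add (hosc.const_mul _)) ?_
        filter_upwards [hK, hM] with y hKy hMy
        have hsplit : -(h y • (A y - a)) - -(h₀ • ((∫ z, A z ∂ν) - a))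
            = -((h y - h₀) • (A y - a) + h₀ • (A y - ∫ z, A z ∂ν)) := by
          module
        rw [hsplit, norm_neg]
        refine (norm_add_le _ _).trans ?_
        rw [norm_smul, norm_smul, Real.norm_eq_abs, Real.norm_eq_abs]
        have := (abs_nonneg _).trans hKy
        gcongr
    _ = K * M + H * ∫ y, ‖A y - ∫ z, A z ∂ν‖ ∂ν := by
        rw [integral_add (integrable_const _) (hosc.const_mul _), integral_const, probReal_univ,
          one_smul, integral_const_mul]

lemma isProbabilityMeasure_inv_smul_restrict {E : Type*} [MeasurableSpace E] {μ : Measure E}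
    {S : Set E} (h0 : μ S ≠ 0) (hfin : μ S ≠ ⊤) :
    IsProbabilityMeasure ((μ.restrict S univ)⁻¹ • μ.restrict S) :=
  ⟨by simp [ENNReal.inv_mul_cancel h0 hfin]⟩

lemma ae_inv_smul_restrict {E : Type*} [MeasurableSpace E] {μ : Measure E} {S : Set E}
    (hS : MeasurableSet S) {p : E → Prop} (hp : ∀ y ∈ S, p y) :
    ∀ᵐ y ∂((μ.restrict S univ)⁻¹ • μ.restrict S), p y :=
  Measure.ae_smul_measure (ae_restrict_of_forall_mem hS hp) _

/-- conditional form of Lemma 3.3: with `r = |x0 - y0|/5`, `η` Lipschitz with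
constant `4/δ`, `0 ≤ η ≤ 1`, and `G` satisfying the Green's-function-type bounds
`|G(x)| ≤ C0 |x-x0|^{2-n}` and the oscillation bound (ii), the function
`g = -η (A - A(x0)) G` satisfies, for `0 < t ≤ r`,
`ω_g(t, Ω(y0,2r)) ≤ C r^{2-n} (ω_A(t) + ((r+δ)/(δr)) ϱ_A(8r,x0) t)` with `C = C(n,Λ0,C0)`.
Matrices `ℝ^{n×n}` are modelled as `EuclideanSpace ℝ (Fin n × Fin n)`. -/
theorem meanOsc_cutoff_green_bound
    (n : ℕ) (hn : 3 ≤ n) (Λ0 C0 : ℝ) (hΛ0 : 0 ≤ Λ0) (hC0 : 0 ≤ C0) :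
    ∃ C : ℝ, 0 < C ∧
    ∀ (Ω : Set (EuclideanSpace ℝ (Fin n))), Bornology.IsBounded Ω → IsOpen Ω →
    ∀ (A : EuclideanSpace ℝ (Fin n) → EuclideanSpace ℝ (Fin n × Fin n)), Measurable A →
    ∀ x0 ∈ Ω, (∀ x ∈ Ω, ‖A x - A x0‖ ≤ Λ0) →
    ∀ y0 ∈ Ω, y0 ≠ x0 →
    ∀ r : ℝ, r = dist x0 y0 / 5 →
    ∀ δ : ℝ, 0 < δ →
    ∀ η : EuclideanSpace ℝ (Fin n) → ℝ, (∀ x, η x ∈ Icc (0:ℝ) 1) →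
      LipschitzWith (Real.toNNReal (4 / δ)) η →
    ∀ G : EuclideanSpace ℝ (Fin n) → ℝ, Measurable G →
      (∀ x ∈ Ω \ {x0}, |G x| ≤ C0 * ‖x - x0‖ ^ ((2:ℝ) - n)) →
      (∀ t ∈ Ioc (0:ℝ) r, ∀ xb ∈ Ω ∩ ball y0 (2 * r),
        ∀ x ∈ Ω ∩ ball xb t, ∀ y ∈ Ω ∩ ball xb t,
          |G x - G y| ≤ C0 * t * r ^ ((1:ℝ) - n)) →
    ∀ t ∈ Ioc (0:ℝ) r,
      meanOscSup n Ω (fun x => -((η x * G x) • (A x - A x0))) t (Ω ∩ ball y0 (2 * r))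
        ≤ C * r ^ ((2:ℝ) - n) *
            (meanOscSup n Ω A t Ω
              + ((r + δ) / (δ * r)) * modCont n Ω A (8 * r) x0 * t) := by
  refine ⟨8 * C0 + 1, by positivity, ?_⟩
  intro Ω hΩb hΩ A hA x0 hx0 hAΛ y0 hy0 hne r hr δ hδ η hη hηL G hG hG1 hG2 t ht
  have hr0 : 0 < r := by
    rw [hr]
    have := dist_pos.2 hne.symm
    positivity
  obtain ⟨ht0, htr⟩ := ht
  have hprob : ∀ x ∈ Ω, IsProbabilityMeasure
      ((volume.restrict (Ω ∩ ball x t) univ)⁻¹ • volume.restrict (Ω ∩ ball x t)) := fun x hx =>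
    isProbabilityMeasure_inv_smul_restrict
      ((hΩ.inter isOpen_ball).measure_pos volume ⟨x, hx, mem_ball_self ht0⟩).ne'
      (hΩb.subset inter_subset_left).measure_lt_top.ne
  have hmeas : ∀ x, MeasurableSet (Ω ∩ ball x t) := fun x =>
    (hΩ.inter isOpen_ball).measurableSet
  have hAint : ∀ x ∈ Ω, Integrable A
      ((volume.restrict (Ω ∩ ball x t) univ)⁻¹ • volume.restrict (Ω ∩ ball x t)) := by
    intro x hx
    have := hprob x hx
    refine Integrable.of_bound hA.aestronglyMeasurable (Λ0 + ‖A x0‖) ?_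
    refine ae_inv_smul_restrict (hmeas x) fun y hy => ?_
    have h1 := norm_add_le (A y - A x0) (A x0)
    rw [sub_add_cancel] at h1
    linarith [hAΛ y hy.1]
  have hbddA : BddAbove ((fun x => meanOsc n Ω A t x) '' Ω) := by
    refine ⟨2 * Λ0, ?_⟩
    rintro _ ⟨x, hx, rfl⟩
    have := hprob x hx
    refine (integral_norm_sub_integral_le (hAint x hx) (A x0)).trans ?_
    refine mul_le_mul_of_nonneg_left ?_ zero_le_two
    refine (integral_mono_ae ((hAint x hx).sub (integrable_const _)).norm
      (integrable_const Λ0) (ae_inv_smul_restrict (hmeas x) fun y hy => hAΛ y hy.1)).trans ?_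
    rw [integral_const, probReal_univ, one_smul]
  have hmod : ∀ x ∈ Ω, dist x x0 ≤ 8 * r → ‖A x - A x0‖ ≤ modCont n Ω A (8 * r) x0 := by
    intro x hx hxr
    refine le_csSup ⟨Λ0, ?_⟩ ⟨x, hx, hxr, rfl⟩
    rintro _ ⟨z, hz, -, rfl⟩
    exact hAΛ z hz
  have hmod0 : 0 ≤ modCont n Ω A (8 * r) x0 :=
    (norm_nonneg _).trans (hmod x0 hx0 (by rw [dist_self]; positivity))
  have hGr : ∀ x ∈ Ω, r ≤ dist x x0 → |G x| ≤ C0 * r ^ ((2:ℝ) - n) := by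
    intro x hx hxr
    refine (hG1 x ⟨hx, fun h => ?_⟩).trans ?_
    · rw [mem_singleton_iff.1 h, dist_self] at hxr
      linarith
    · refine mul_le_mul_of_nonneg_left ?_ hC0
      rw [← dist_eq_norm]
      refine Real.rpow_le_rpow_of_nonpos hr0 hxr ?_
      have : (3:ℝ) ≤ n := by exact_mod_cast hn
      linarith
  refine csSup_le ⟨_, y0, ⟨hy0, mem_ball_self (by positivity)⟩, rfl⟩ ?_
  rintro _ ⟨xb, hxb, rfl⟩
  have hν := hprob xb hxb.1
  have hd0 : dist x0 y0 = 5 * r := by linarith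
  have hxby : dist xb y0 < 2 * r := hxb.2
  have hfar : ∀ y ∈ Ω ∩ ball xb t, r ≤ dist y x0 ∧ dist y x0 ≤ 8 * r := by
    rintro y ⟨-, hy⟩
    rw [mem_ball] at hy
    have h1 := dist_triangle y xb y0
    have h2 := dist_triangle x0 y y0
    have h3 := dist_triangle y y0 x0
    rw [dist_comm x0 y] at h2
    rw [dist_comm y0 x0] at h3
    constructor <;> linarith
  have hxbS : xb ∈ Ω ∩ ball xb t := ⟨hxb.1, mem_ball_self ht0⟩
  have hηabs : ∀ x, |η x| ≤ 1 := fun x => abs_le.2 ⟨by linarith [(hη x).1], (hη x).2⟩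
  have hprod : ∀ y ∈ Ω ∩ ball xb t, |η y * G y| ≤ C0 * r ^ ((2:ℝ) - n) := by
    intro y hy
    rw [abs_mul]
    have := mul_le_mul (hηabs y) (hGr y hy.1 (hfar y hy).1) (abs_nonneg _) zero_le_one
    linarith
  have hrpow : r ^ ((1:ℝ) - n) = r ^ ((2:ℝ) - n) / r := by
    rw [← Real.rpow_sub_one hr0.ne']
    congr 1
    ring
  have hK : ∀ y ∈ Ω ∩ ball xb t, |η y * G y - η xb * G xb| ≤
      4 * C0 * r ^ ((2:ℝ) - n) * ((r + δ) / (δ * r)) * t := by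
    intro y hy
    have hy2 := hy.2
    rw [mem_ball] at hy2
    have hηy : |η y - η xb| ≤ 4 / δ * t := by
      have h := hηL.dist_le_mul y xb
      rw [Real.dist_eq, Real.coe_toNNReal _ (by positivity)] at h
      exact h.trans (by gcongr)
    have hGy := hG2 t ⟨ht0, htr⟩ xb hxb y hy xb hxbS
    have hsplit : η y * G y - η xb * G xb = (η y - η xb) * G y + η xb * (G y - G xb) := by ring
    calc |η y * G y - η xb * G xb|
        ≤ |η y - η xb| * |G y| + |η xb| * |G y - G xb| := by
          rw [hsplit, ← abs_mul, ← abs_mul]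
          exact abs_add_le _ _
      _ ≤ (4 / δ * t) * (C0 * r ^ ((2:ℝ) - n)) + 1 * (C0 * t * r ^ ((1:ℝ) - n)) := by
          gcongr
          · exact hGr y hy.1 (hfar y hy).1
          · exact hηabs xb
      _ ≤ (4 / δ * t) * (C0 * r ^ ((2:ℝ) - n)) + 4 * (C0 * t * r ^ ((1:ℝ) - n)) := by
          gcongr
          norm_num
      _ = 4 * C0 * r ^ ((2:ℝ) - n) * ((r + δ) / (δ * r)) * t := by
          rw [hrpow]
          field_simp
  have hgint : Integrable (fun y => -((η y * G y) • (A y - A x0)))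
      ((volume.restrict (Ω ∩ ball xb t) univ)⁻¹ • volume.restrict (Ω ∩ ball xb t)) := by
    refine Integrable.of_bound ?_ (C0 * r ^ ((2:ℝ) - n) * Λ0) ?_
    · have := hηL.continuous.measurable
      exact Measurable.aestronglyMeasurable (by fun_prop)
    · refine ae_inv_smul_restrict (hmeas xb) fun y hy => ?_
      rw [norm_neg, norm_smul, Real.norm_eq_abs]
      exact mul_le_mul (hprod y hy) (hAΛ y hy.1) (norm_nonneg _) (by positivity)
  have hmain := integral_norm_neg_smul_sub_integral_le (hAint xb hxb.1) hgint
    (ae_inv_smul_restrict (hmeas xb) hK)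
    (ae_inv_smul_restrict (hmeas xb) fun y hy => hmod y hy.1 (hfar y hy).2) (hprod xb hxbS)
  have hωA : meanOsc n Ω A t xb ≤ meanOscSup n Ω A t Ω := le_csSup hbddA ⟨xb, hxb.1, rfl⟩
  have hωA0 : 0 ≤ meanOsc n Ω A t xb := integral_nonneg fun _ => norm_nonneg _
  have hω0 := hωA0.trans hωA
  set P := r ^ ((2:ℝ) - n)
  set Q := (r + δ) / (δ * r)
  set m := modCont n Ω A (8 * r) x0
  set W := meanOscSup n Ω A t Ω
  have hP : 0 ≤ P := by positivity
  have hQ : 0 ≤ Q := by positivity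
  calc meanOsc n Ω (fun x => -((η x * G x) • (A x - A x0))) t xb
      ≤ 2 * (4 * C0 * P * Q * t * m + C0 * P * meanOsc n Ω A t xb) := hmain
    _ ≤ 2 * (4 * C0 * P * Q * t * m + C0 * P * W) := by gcongr
    _ ≤ 2 * (4 * C0 * P * Q * t * m + C0 * P * W) + (6 * C0 * P * W + P * (W + Q * m * t)) :=
        le_add_of_nonneg_right (by positivity)
    _ = (8 * C0 + 1) * P * (W + Q * m * t) := by ring
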